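/- Let H : ℝ → ℝ be the Heaviside function with H(x) = 1 for x ≥ 0 and H(x) = 0 for x < 0. Fix reals β_lo < β_hi and α, and define the FQ BMRU scalar update F(ĥ, h) = z_hi·α + (1 − z_lo)(1 − z_hi)·h with z_lo = H(β_lo − ĥ), z_hi = H(ĥ − β_hi). Let (ĥ_t)_{t=1}^T be a candidate sequence and (δ_t)_{t=1}^T a noise sequence such that for every t, ĥ_t ∉ {β_lo, β_hi} and |δ_t| < dist(ĥ_t, {β_lo, β_hi}). Define the clean trajectory h_0 = h₀, h_t = F(ĥ_t, h_{t-1}) and the noisy trajectory h'_0 = h₀, h'_t = F(ĥ_t + δ_t, h'_{t-1}) from the same initial state h₀ ∈ ℝ. Then h'_t = h_t for every t = 0, 1, …, T: bounded candidate noise does not accumulate through the recurrent feedback. -/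

import Mathlib

/-- Heaviside function: `H x = 1` for `x ≥ 0`, `H x = 0` for `x < 0`. -/
noncomputable def Hside (x : ℝ) : ℝ := if 0 ≤ x then 1 else 0

/-- Multi-step structural noise immunity of the FQ BMRU: bounded candidate
noise (strictly below the distance to the threshold set at every step) does
not accumulate through the recurrent feedback — the noisy trajectory equals
the clean one at every time step. -/
theorem fq_bmru_multi_step_noise_immunity
    (βlo βhi a : ℝ) (hβ : βlo < βhi)
    (F : ℝ → ℝ → ℝ)
    (hF : ∀ x h, F x h =
      Hside (x - βhi) * a + (1 - Hside (βlo - x)) * (1 - Hside (x - βhi)) * h)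
    (T : ℕ) (xs δs : ℕ → ℝ)
    (hsep : ∀ t, 1 ≤ t → t ≤ T →
      xs t ≠ βlo ∧ xs t ≠ βhi ∧ |δs t| < min |xs t - βlo| |xs t - βhi|)
    (h0 : ℝ) (h h' : ℕ → ℝ)
    (hinit : h 0 = h0) (hinit' : h' 0 = h0)
    (hstep : ∀ t, t < T → h (t + 1) = F (xs (t + 1)) (h t))
    (hstep' : ∀ t, t < T → h' (t + 1) = F (xs (t + 1) + δs (t + 1)) (h' t)) :
    ∀ t, t ≤ T → h' t = h t := by
  have key : ∀ x d b : ℝ, |d| < |x - b| → ((0 ≤ x + d - b ↔ 0 ≤ x - b) ∧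
      (0 ≤ b - (x + d) ↔ 0 ≤ b - x)) := by
    intro x d b hd
    have h1 := le_abs_self d
    have h2 := neg_abs_le d
    rcases abs_cases (x - b) with ⟨e, _⟩ | ⟨e, _⟩ <;> rw [e] at hd <;>
      refine ⟨⟨fun _ => ?_, fun _ => ?_⟩, ⟨fun _ => ?_, fun _ => ?_⟩⟩ <;>
      linarith [abs_nonneg d]
  intro t
  induction t with
  | zero => intro _; rw [hinit, hinit']
  | succ n ih =>
    intro hn
    obtain ⟨_, _, hd⟩ := hsep (n + 1) (by omega) hn
    have hlo := (key _ _ _ (lt_of_lt_of_le hd (min_le_left _ _))).2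
    have hhi := (key _ _ _ (lt_of_lt_of_le hd (min_le_right _ _))).1
    rw [hstep n (by omega), hstep' n (by omega), ih (by omega), hF, hF]
    simp only [Hside, hlo, hhi]
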